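/- arXiv:1805.12377 — 2 statements merged into one kernel-verified Lean document; each statement's English description precedes it below -/
import Mathlib

section
/- There exists a constant c ∈ [1,∞) such that for all K ∈ ℕ one has (1/c)·√(1+log K) ≤ D₂(ℓ^∞_K) ≤ c·√(1+log K), where ℓ^∞_K is ℝ^K equipped with the supremum norm. -/
open MeasureTheory ProbabilityTheory Filter Set
open scoped ENNReal NNReal Topology

noncomputable section

/-- The uniform measure on `Bool` (a fair coin). -/
def unifBool : Measure Bool :=
  (2 : ℝ≥0∞)⁻¹ • Measure.dirac true + (2 : ℝ≥0∞)⁻¹ • Measure.dirac false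

instance : IsProbabilityMeasure unifBool := by
  constructor
  simp [unifBool, ENNReal.inv_two_add_inv_two]

/-- The canonical probability space of `N` independent fair coins. -/
def bern (N : ℕ) : Measure (Fin N → Bool) := Measure.pi fun _ => unifBool

instance (N : ℕ) : IsProbabilityMeasure (bern N) := by
  unfold bern; infer_instance

/-- The Rademacher variable associated to a coin flip. -/
def rad (b : Bool) : ℝ := if b then 1 else -1

/-- `v n` depends only on the first `n` coordinates, i.e. `v n = f n (r 1, …, r n)`. -/
def DyadicAdapted {X : Type*} {N : ℕ} (v : ℕ → (Fin N → Bool) → X) : Prop :=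
  ∀ (n : ℕ) (ω ω' : Fin N → Bool), (∀ i : Fin N, (i : ℕ) < n → ω i = ω' i) → v n ω = v n ω'

/-- `c` is an upper decoupling constant for `X`-valued dyadic martingales in `L^p`. -/
def DecIneq (p : ℝ) (X : Type*) [NormedAddCommGroup X] [NormedSpace ℝ X] (c : ℝ≥0∞) : Prop :=
  ∀ N : ℕ, 2 ≤ N → ∀ v : ℕ → (Fin N → Bool) → X, DyadicAdapted v →
    eLpNorm (fun ω => ∑ n : Fin N, rad (ω n) • v (n : ℕ) ω) (ENNReal.ofReal p) (bern N) ≤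
      c * eLpNorm (fun z : (Fin N → Bool) × (Fin N → Bool) =>
        ∑ n : Fin N, rad (z.2 n) • v (n : ℕ) z.1) (ENNReal.ofReal p) ((bern N).prod (bern N))

/-- The dyadic decoupling constant `D_p(X) ∈ [0,∞]`. -/
def Dp (p : ℝ) (X : Type*) [NormedAddCommGroup X] [NormedSpace ℝ X] : ℝ≥0∞ :=
  sInf {c : ℝ≥0∞ | DecIneq p X c}


/-- flip of the `n`-th coin -/
def flipAt {N : ℕ} (n : Fin N) (ω : Fin N → Bool) : Fin N → Bool := Function.update ω n (!ω n)

lemma flipAt_invol {N : ℕ} (n : Fin N) : Function.Involutive (flipAt n) := by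
  intro ω
  simp [flipAt]

lemma sum_flip {N : ℕ} (n : Fin N) (F : (Fin N → Bool) → ℝ) :
    ∑ ω, F (flipAt n ω) = ∑ ω, F ω :=
  Equiv.sum_comp (flipAt_invol n).toPerm F

lemma sum_le_of_flip {N : ℕ} (n : Fin N) (F G : (Fin N → Bool) → ℝ)
    (h : ∀ ω, F ω + F (flipAt n ω) ≤ 2 * G ω) : ∑ ω, F ω ≤ ∑ ω, G ω := by
  have h1 : ∑ ω, (F ω + F (flipAt n ω)) ≤ ∑ ω, 2 * G ω := Finset.sum_le_sum fun ω _ => h ω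
  rw [Finset.sum_add_distrib, sum_flip, ← Finset.mul_sum] at h1
  linarith

/-- Rademacher function indexed by naturals -/
def rr {N : ℕ} (j : ℕ) (ω : Fin N → Bool) : ℝ := if h : j < N then rad (ω ⟨j, h⟩) else 0

lemma rad_sq (b : Bool) : rad b ^ 2 = 1 := by cases b <;> simp [rad]
lemma rad_not (b : Bool) : rad (!b) = - rad b := by cases b <;> simp [rad]
lemma rad_abs (b : Bool) : |rad b| = 1 := by cases b <;> simp [rad]
lemma rad_or (b : Bool) : rad b = 1 ∨ rad b = -1 := by cases b <;> simp [rad]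

lemma rr_flip_self {N : ℕ} (n : Fin N) (ω : Fin N → Bool) : rr n (flipAt n ω) = - rr n ω := by
  simp [rr, flipAt, rad_not]

lemma rr_flip_ne {N : ℕ} (n : Fin N) (j : ℕ) (hj : j ≠ n) (ω : Fin N → Bool) :
    rr j (flipAt n ω) = rr j ω := by
  unfold rr flipAt
  split_ifs with h
  · rw [Function.update_of_ne]
    intro h'
    apply hj
    rw [← h']
  · rfl

lemma adapted_flip {X : Type*} {N : ℕ} {v : ℕ → (Fin N → Bool) → X} (hv : DyadicAdapted v)
    (n : Fin N) (j : ℕ) (hj : j ≤ n) (ω : Fin N → Bool) : v j (flipAt n ω) = v j ω := by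
  apply hv
  intro i hi
  unfold flipAt
  rw [Function.update_of_ne]
  rintro rfl
  omega

/-- the Bellman function -/
def UU (m : ℕ) (x s a : ℝ) : ℝ := a * ((x ^ 2 + 3 * m * (a - s)) / a) ^ m

lemma pow_exp_bound (m : ℕ) (y z : ℝ) (hy : 0 < y) (h : 0 ≤ y + z) :
    (y + z) ^ m ≤ y ^ m * Real.exp (m * (z / y)) := by
  have h1 : y + z ≤ y * Real.exp (z / y) := by
    have := Real.add_one_le_exp (z / y)
    calc y + z = y * (z / y + 1) := by field_simp; ring
      _ ≤ _ := by gcongr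
  calc (y + z) ^ m ≤ (y * Real.exp (z / y)) ^ m := by gcongr
    _ = _ := by rw [mul_pow, ← Real.exp_nat_mul]

lemma VV_step (m : ℕ) (hm : 1 ≤ m) (x d B : ℝ) (hB : 3 * m * d ^ 2 ≤ B) :
    ((x + d) ^ 2 + (B - 3 * m * d ^ 2)) ^ m + ((x - d) ^ 2 + (B - 3 * m * d ^ 2)) ^ m ≤
      2 * (x ^ 2 + B) ^ m := by
  have hm' : (1 : ℝ) ≤ m := by exact_mod_cast hm
  have hd : 0 ≤ d ^ 2 := sq_nonneg d
  have hB0 : 0 ≤ B := le_trans (by positivity) hB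
  rcases (show (0:ℝ) ≤ x ^ 2 + B by positivity).eq_or_lt with h0 | hy
  · have hx : x ^ 2 = 0 := by nlinarith [sq_nonneg x]
    have hB' : B = 0 := by nlinarith [sq_nonneg x]
    have hd' : d ^ 2 = 0 := by nlinarith
    have hx1 : x = 0 := by simpa using hx
    have hd1 : d = 0 := by simpa using hd'
    subst hx1 hd1 hB'
    have : m ≠ 0 := by omega
    simp [this]
  set y := x ^ 2 + B with hyd
  have e1 : (x + d) ^ 2 + (B - 3 * m * d ^ 2) = y + (2 * x * d - (3 * m - 1) * d ^ 2) := by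
    rw [hyd]; ring
  have e2 : (x - d) ^ 2 + (B - 3 * m * d ^ 2) = y + (-(2 * x * d) - (3 * m - 1) * d ^ 2) := by
    rw [hyd]; ring
  have b1 := pow_exp_bound m y (2 * x * d - (3 * m - 1) * d ^ 2) hy (by rw [← e1]; nlinarith [sq_nonneg (x+d)])
  have b2 := pow_exp_bound m y (-(2 * x * d) - (3 * m - 1) * d ^ 2) hy (by rw [← e2]; nlinarith [sq_nonneg (x-d)])
  rw [e1, e2]
  set t := m * (2 * x * d / y) with ht
  set w := m * ((3 * m - 1) * d ^ 2 / y) with hw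
  have f1 : (m : ℝ) * ((2 * x * d - (3 * m - 1) * d ^ 2) / y) = t + -w := by rw [ht, hw]; ring
  have f2 : (m : ℝ) * ((-(2 * x * d) - (3 * m - 1) * d ^ 2) / y) = -t + -w := by rw [ht, hw]; ring
  rw [f1, Real.exp_add] at b1
  rw [f2, Real.exp_add] at b2
  have hc := Real.cosh_le_exp_half_sq t
  have htw : t ^ 2 / 2 ≤ w := by
    have : t ^ 2 / 2 = 2 * m ^ 2 * d ^ 2 / y * (x ^ 2 / y) := by
      rw [ht]; field_simp
    rw [this]
    have h1 : x ^ 2 / y ≤ 1 := by rw [div_le_one hy]; linarith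
    calc 2 * m ^ 2 * d ^ 2 / y * (x ^ 2 / y) ≤ 2 * m ^ 2 * d ^ 2 / y * 1 := by gcongr
      _ = m * (2 * m * d ^ 2 / y) := by ring
      _ ≤ w := by rw [hw]; gcongr; linarith
  have hcw : Real.cosh t * Real.exp (-w) ≤ 1 := by
    calc Real.cosh t * Real.exp (-w) ≤ Real.exp (t ^ 2 / 2) * Real.exp (-w) := by gcongr
      _ = Real.exp (t ^ 2 / 2 - w) := by rw [← Real.exp_add]; ring_nf
      _ ≤ 1 := by rw [Real.exp_le_one_iff]; linarith
  have : y ^ m * (Real.exp t * Real.exp (-w)) + y ^ m * (Real.exp (-t) * Real.exp (-w)) =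
      2 * (y ^ m * (Real.cosh t * Real.exp (-w))) := by
    rw [Real.cosh_eq]; ring
  have h3 : y ^ m * (Real.cosh t * Real.exp (-w)) ≤ y ^ m * 1 := by gcongr
  linarith

lemma UU_step (m : ℕ) (hm : 1 ≤ m) (x d s a : ℝ) (ha : 0 < a) (hs : s + d ^ 2 ≤ a) :
    UU m (x + d) (s + d ^ 2) a + UU m (x - d) (s + d ^ 2) a ≤ 2 * UU m x s a := by
  have h := VV_step m hm x d (3 * m * (a - s)) (by gcongr; linarith)
  unfold UU
  simp only [div_pow]
  have e : 3 * (m:ℝ) * (a - (s + d ^ 2)) = 3 * m * (a - s) - 3 * m * d ^ 2 := by ring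
  rw [e]
  have hp : 0 ≤ a / a ^ m := by positivity
  have h2 := mul_le_mul_of_nonneg_right h hp
  calc _ = (((x + d) ^ 2 + (3 * m * (a - s) - 3 * m * d ^ 2)) ^ m +
        ((x - d) ^ 2 + (3 * m * (a - s) - 3 * m * d ^ 2)) ^ m) * (a / a ^ m) := by ring
    _ ≤ _ := h2
    _ = _ := by ring

lemma UU_mono (m : ℕ) (hm : 2 ≤ m) (x s a a' : ℝ) (ha : 0 < a) (hs : s ≤ a) (haa : a ≤ a') :
    UU m x s a' ≤ UU m x s a + 3 * m ^ 2 * (6 * m) ^ (m - 1) * (a' - a) := by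
  have hm' : (2 : ℝ) ≤ m := by exact_mod_cast hm
  have ha' : 0 < a' := by linarith
  unfold UU
  set w := (x ^ 2 + 3 * m * (a - s)) / a with hw
  set w' := (x ^ 2 + 3 * m * (a' - s)) / a' with hw'
  have w0 : 0 ≤ w := by
    have : 0 ≤ a - s := by linarith
    positivity
  have w0' : 0 ≤ w' := by
    have : 0 ≤ a' - s := by linarith
    positivity
  obtain ⟨p, rfl⟩ : ∃ p, m = p + 1 := ⟨m - 1, by omega⟩
  have hdiff : a * (w - w') = (w' - 3 * ((p + 1 : ℕ):ℝ)) * (a' - a) := by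
    rw [hw, hw']; field_simp; ring
  have htan : w' ^ (p+1) + (p+1:ℕ) * w' ^ p * (w - w') ≤ w ^ (p+1) := by
    rcases w0'.eq_or_lt with h0 | hpos
    · rw [← h0]
      have hp : p ≠ 0 := by omega
      simp [hp]; positivity
    · have hb := one_add_mul_le_pow (a := w / w' - 1) (by have : 0 ≤ w / w' := by positivity
                                                          linarith) (p+1)
      have : w ^ (p+1) = w' ^ (p+1) * (1 + (w / w' - 1)) ^ (p+1) := by
        rw [← mul_pow]; congr 1; field_simp; ring
      rw [this]
      calc _ = w' ^ (p+1) * (1 + ((p+1 : ℕ):ℝ) * (w / w' - 1)) := by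
            field_simp; ring
        _ ≤ _ := by gcongr
  have h1 : a * (w' ^ (p+1) + (p+1:ℕ) * w' ^ p * (w - w')) ≤ a * w ^ (p+1) := by gcongr
  have h2 : a * (w' ^ (p+1) + (p+1:ℕ) * w' ^ p * (w - w')) = a * w' ^ (p+1) +
      (p+1:ℕ) * w' ^ p * ((w' - 3 * ((p + 1 : ℕ):ℝ)) * (a' - a)) := by rw [← hdiff]; ring
  have h3 : w' ^ p * (w' - (p+1:ℕ) * (w' - 3 * ((p + 1 : ℕ):ℝ))) ≤
      3 * ((p+1 : ℕ):ℝ) ^ 2 * (6 * ((p+1 : ℕ):ℝ)) ^ (p + 1 - 1) := by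
    simp only [Nat.add_sub_cancel]
    by_cases hc : w' ≤ 6 * ((p+1 : ℕ):ℝ)
    · calc _ ≤ w' ^ p * (3 * ((p+1 : ℕ):ℝ) ^ 2) := by gcongr; nlinarith
        _ ≤ (6 * ((p+1 : ℕ):ℝ)) ^ p * (3 * ((p+1 : ℕ):ℝ) ^ 2) := by gcongr
        _ = _ := by ring
    · push Not at hc
      have : w' - (p+1:ℕ) * (w' - 3 * ((p + 1 : ℕ):ℝ)) ≤ 0 := by nlinarith
      have h5 : 0 ≤ w' ^ p := by positivity
      calc _ ≤ (0:ℝ) := by nlinarith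
        _ ≤ _ := by positivity
  have h4 : 0 ≤ a' - a := by linarith
  have h5 := mul_le_mul_of_nonneg_right h3 h4
  have h6 : a' * w' ^ (p+1) = a * w' ^ (p+1) + (a' - a) * (w' ^ p * w') := by ring
  nlinarith

lemma scalar_bound {N : ℕ} (m : ℕ) (hm : 2 ≤ m) (u : ℕ → (Fin N → Bool) → ℝ)
    (hu : DyadicAdapted u) (a : ℕ → (Fin N → Bool) → ℝ) (ha : ∀ n ω, 0 < a n ω)
    (has : ∀ n ω, ∑ j ∈ Finset.range n, u j ω ^ 2 ≤ a n ω)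
    (hmono : ∀ n ω, a n ω ≤ a (n + 1) ω)
    (hinv : ∀ (n : Fin N) ω, a (n + 1) (flipAt n ω) = a (n + 1) ω) :
    ∑ ω, a N ω * ((∑ j ∈ Finset.range N, rr j ω * u j ω) ^ 2 / a N ω) ^ m ≤
      3 * m ^ 2 * (6 * m) ^ (m - 1) * ∑ ω, a N ω := by
  set c : ℝ := 3 * m ^ 2 * (6 * m) ^ (m - 1) with hc
  have hm' : (2 : ℝ) ≤ m := by exact_mod_cast hm
  have key : ∀ n, n ≤ N → ∑ ω, (UU m (∑ j ∈ Finset.range n, rr j ω * u j ω)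
      (∑ j ∈ Finset.range n, u j ω ^ 2) (a n ω) - c * a n ω) ≤ 0 := by
    intro n
    induction n with
    | zero =>
      intro _
      apply Finset.sum_nonpos
      intro ω _
      have h0 := ha 0 ω
      simp only [UU, Finset.range_zero, Finset.sum_empty]
      have : ((0:ℝ) ^ 2 + 3 * m * (a 0 ω - 0)) / a 0 ω = 3 * m := by field_simp; ring
      rw [this]
      have : (3 * (m:ℝ)) ^ m ≤ c := by
        obtain ⟨p, rfl⟩ : ∃ p, m = p + 1 := ⟨m - 1, by omega⟩
        rw [hc, pow_succ]
        simp only [Nat.add_sub_cancel]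
        calc (3 * ((p+1:ℕ):ℝ)) ^ p * (3 * ((p+1:ℕ):ℝ)) ≤ (6 * ((p+1:ℕ):ℝ)) ^ p * (3 * ((p+1:ℕ):ℝ) ^ 2) := by
              gcongr
              · norm_num
              · nlinarith
          _ = _ := by ring
      nlinarith
    | succ n ih =>
      intro hn
      refine le_trans ?_ (ih (by omega))
      apply sum_le_of_flip ⟨n, by omega⟩
      intro ω
      set nn : Fin N := ⟨n, by omega⟩ with hnn
      have hx : ∑ j ∈ Finset.range n, rr j (flipAt nn ω) * u j (flipAt nn ω) =
          ∑ j ∈ Finset.range n, rr j ω * u j ω := by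
        apply Finset.sum_congr rfl
        intro j hj
        rw [Finset.mem_range] at hj
        rw [rr_flip_ne nn j (by simp [hnn]; omega), adapted_flip hu nn j (by simp [hnn]; omega)]
      have hs : ∑ j ∈ Finset.range n, u j (flipAt nn ω) ^ 2 =
          ∑ j ∈ Finset.range n, u j ω ^ 2 := by
        apply Finset.sum_congr rfl
        intro j hj
        rw [Finset.mem_range] at hj
        rw [adapted_flip hu nn j (by simp [hnn]; omega)]
      have hA : a (n+1) (flipAt nn ω) = a (n+1) ω := hinv nn ω
      have hun : u n (flipAt nn ω) = u n ω := adapted_flip hu nn n (by simp [hnn]) ω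
      have hr : rr n (flipAt nn ω) = - rr n ω := rr_flip_self nn ω
      have hasn := has (n+1) ω
      simp only [Finset.sum_range_succ] at hasn ⊢
      rw [hx, hs, hA, hun, hr]
      set x := ∑ j ∈ Finset.range n, rr j ω * u j ω
      set s := ∑ j ∈ Finset.range n, u j ω ^ 2 with hsd
      have hrsq : (rr n ω * u n ω) ^ 2 = u n ω ^ 2 := by
        rw [mul_pow]
        simp [rr, show n < N by omega, rad_sq]
      have h1 := UU_step m (by omega) x (rr n ω * u n ω) s (a (n+1) ω) (ha _ _) (by rw [hrsq]; exact hasn)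
      have h2 := UU_mono m hm x s (a n ω) (a (n+1) ω) (ha _ _) (has n ω) (hmono n ω)
      rw [hrsq] at h1
      rw [neg_mul, ← sub_eq_add_neg]
      rw [← hc] at h2
      nlinarith
  have h := key N le_rfl
  rw [Finset.sum_sub_distrib, ← Finset.mul_sum] at h
  refine le_trans (Finset.sum_le_sum fun ω _ => ?_) (sub_nonpos.mp h)
  unfold UU
  have h0 := ha N ω
  have h1 := has N ω
  gcongr
  have : 0 ≤ a N ω - ∑ j ∈ Finset.range N, u j ω ^ 2 := by linarith
  have : 0 ≤ 3 * (m:ℝ) * (a N ω - ∑ j ∈ Finset.range N, u j ω ^ 2) := by positivity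
  linarith

lemma sum_eq_of_flip {N : ℕ} (n : Fin N) (F G : (Fin N → Bool) → ℝ)
    (h : ∀ ω, F ω + F (flipAt n ω) = 2 * G ω) : ∑ ω, F ω = ∑ ω, G ω := by
  have h1 : ∑ ω, (F ω + F (flipAt n ω)) = ∑ ω, 2 * G ω := Finset.sum_congr rfl fun ω _ => h ω
  rw [Finset.sum_add_distrib, sum_flip, ← Finset.mul_sum] at h1
  linarith

/-- a random walk with deterministic weights -/
def WW {N : ℕ} (b : ℕ → ℝ) (n : ℕ) (ω : Fin N → Bool) : ℝ := ∑ j ∈ Finset.range n, rr j ω * b j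

lemma WW_succ {N : ℕ} (b : ℕ → ℝ) (n : ℕ) (ω : Fin N → Bool) :
    WW b (n + 1) ω = WW b n ω + rr n ω * b n := by
  simp [WW, Finset.sum_range_succ]

lemma WW_flip {N : ℕ} (b : ℕ → ℝ) (n : Fin N) (j : ℕ) (hj : j ≤ n) (ω : Fin N → Bool) :
    WW b j (flipAt n ω) = WW b j ω := by
  unfold WW
  apply Finset.sum_congr rfl
  intro i hi
  rw [Finset.mem_range] at hi
  rw [rr_flip_ne n i (by omega)]

lemma rr_sq {N : ℕ} (n : ℕ) (hn : n < N) (ω : Fin N → Bool) : rr n ω ^ 2 = 1 := by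
  simp [rr, hn, rad_sq]

lemma WW_orth {N : ℕ} (b : ℕ → ℝ) (n : ℕ) (hn : n ≤ N) :
    ∑ ω : Fin N → Bool, WW b n ω ^ 2 = 2 ^ N * ∑ j ∈ Finset.range n, b j ^ 2 := by
  induction n with
  | zero => simp [WW]
  | succ n ih =>
    have h := sum_eq_of_flip (N := N) ⟨n, by omega⟩ (fun ω => WW b (n+1) ω ^ 2)
      (fun ω => WW b n ω ^ 2 + b n ^ 2) (by
        intro ω
        simp only [WW_succ]
        rw [WW_flip b ⟨n, by omega⟩ n le_rfl]
        have h1 : rr n (flipAt (⟨n, by omega⟩ : Fin N) ω) = - rr n ω := rr_flip_self (⟨n, by omega⟩ : Fin N) ω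
        rw [h1]
        have := rr_sq n (by omega) ω
        linear_combination 2 * b n ^ 2 * this)
    rw [h, Finset.sum_add_distrib, ih (by omega), Finset.sum_range_succ]
    simp
    ring

/-- running maximum of the walk -/
def MX {N : ℕ} (b : ℕ → ℝ) : ℕ → (Fin N → Bool) → ℝ
  | 0, _ => 0
  | n + 1, ω => max (MX b n ω) |WW b (n + 1) ω|

lemma MX_nonneg {N : ℕ} (b : ℕ → ℝ) (n : ℕ) (ω : Fin N → Bool) : 0 ≤ MX b n ω := by
  induction n with
  | zero => simp [MX]
  | succ n ih => exact le_trans ih (le_max_left _ _)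

lemma MX_mono {N : ℕ} (b : ℕ → ℝ) (ω : Fin N → Bool) : Monotone fun n => MX b n ω :=
  monotone_nat_of_le_succ fun _ => le_max_left _ _

lemma WW_le_MX {N : ℕ} (b : ℕ → ℝ) (n : ℕ) (ω : Fin N → Bool) : |WW b n ω| ≤ MX b n ω := by
  cases n with
  | zero => simp [MX, WW]
  | succ n => exact le_max_right _ _

lemma MX_flip {N : ℕ} (b : ℕ → ℝ) (n : Fin N) (j : ℕ) (hj : j ≤ n) (ω : Fin N → Bool) :
    MX b j (flipAt n ω) = MX b j ω := by
  induction j with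
  | zero => rfl
  | succ j ih => simp only [MX]; rw [ih (by omega), WW_flip b n _ hj]

lemma doob {N : ℕ} (b : ℕ → ℝ) :
    ∑ ω : Fin N → Bool, MX b N ω ^ 2 ≤ 4 * (2 ^ N * ∑ j ∈ Finset.range N, b j ^ 2) := by
  have key : ∀ n, n ≤ N → ∑ ω : Fin N → Bool, (MX b n ω ^ 2 - 2 * MX b n ω * |WW b n ω|) ≤ 0 := by
    intro n
    induction n with
    | zero => intro _; simp [MX]
    | succ n ih =>
      intro hn
      refine le_trans ?_ (ih (by omega))
      apply sum_le_of_flip ⟨n, by omega⟩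
      intro ω
      have aux : ∀ ω : Fin N → Bool, MX b (n+1) ω ^ 2 - 2 * MX b (n+1) ω * |WW b (n+1) ω| ≤
          MX b n ω ^ 2 - 2 * MX b n ω * |WW b (n+1) ω| := by
        intro ω
        simp only [MX]
        rcases le_total (MX b n ω) |WW b (n+1) ω| with h | h
        · rw [max_eq_right h]
          nlinarith [sq_nonneg (MX b n ω - |WW b (n+1) ω|)]
        · rw [max_eq_left h]
      have a1 := aux ω
      have a2 := aux (flipAt ⟨n, by omega⟩ ω)
      rw [MX_flip b ⟨n, by omega⟩ n le_rfl] at a2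
      have hW : |WW b n ω| * 2 ≤ |WW b (n+1) ω| + |WW b (n+1) (flipAt (⟨n, by omega⟩ : Fin N) ω)| := by
        rw [WW_succ, WW_succ, WW_flip b ⟨n, by omega⟩ n le_rfl]
        have h1 : rr n (flipAt (⟨n, by omega⟩ : Fin N) ω) = - rr n ω := rr_flip_self (⟨n, by omega⟩ : Fin N) ω
        rw [h1]
        have := abs_add_le (WW b n ω + rr n ω * b n) (WW b n ω + - rr n ω * b n)
        have e : (WW b n ω + rr n ω * b n) + (WW b n ω + - rr n ω * b n) = WW b n ω * 2 := by ring
        rw [e, abs_mul] at this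
        simpa using this
      have h0 := MX_nonneg b n ω
      nlinarith
  have h := key N le_rfl
  rw [← WW_orth b N le_rfl]
  have h2 : ∑ ω : Fin N → Bool, (MX b N ω ^ 2 / 2 - 2 * WW b N ω ^ 2) ≤
      ∑ ω : Fin N → Bool, (MX b N ω ^ 2 - 2 * MX b N ω * |WW b N ω|) := by
    apply Finset.sum_le_sum
    intro ω _
    rw [← sq_abs (WW b N ω)]
    nlinarith [sq_nonneg (MX b N ω - 2 * |WW b N ω|)]
  rw [Finset.sum_sub_distrib, ← Finset.mul_sum, ← Finset.sum_div] at h2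
  linarith

lemma fin_sum_eq {N K : ℕ} (v : ℕ → Fin K → ℝ) (ω : Fin N → Bool) (k : Fin K) :
    (∑ n : Fin N, rad (ω n) • v (n : ℕ)) k = WW (fun j => v j k) N ω := by
  unfold WW
  rw [Finset.sum_range, Finset.sum_apply]
  apply Finset.sum_congr rfl
  intro i _
  simp [rr]

lemma upper_real_eps {N K : ℕ} (m : ℕ) (hm : 2 ≤ m) (hKm : K ≤ 2 ^ m)
    (v : ℕ → (Fin N → Bool) → Fin K → ℝ) (hv : DyadicAdapted v) (ε : ℝ) (hε : 0 < ε) :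
    ∑ ω : Fin N → Bool, ‖∑ n : Fin N, rad (ω n) • v (n : ℕ) ω‖ ^ 2 ≤
      120 * m * ∑ ω : Fin N → Bool, (ε + ‖fun k => ∑ j ∈ Finset.range N, v j ω k ^ 2‖) := by
  set a : ℕ → (Fin N → Bool) → ℝ := fun n ω => ε + ‖fun k => ∑ j ∈ Finset.range n, v j ω k ^ 2‖ with had
  have hm' : (2 : ℝ) ≤ m := by exact_mod_cast hm
  have ha : ∀ n ω, 0 < a n ω := fun n ω => by simp only [had]; positivity
  have has : ∀ k n ω, ∑ j ∈ Finset.range n, v j ω k ^ 2 ≤ a n ω := by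
    intro k n ω
    have := norm_le_pi_norm (fun k => ∑ j ∈ Finset.range n, v j ω k ^ 2) k
    have h2 := Real.le_norm_self (∑ j ∈ Finset.range n, v j ω k ^ 2)
    simp only [had]
    linarith
  have hmono : ∀ n ω, a n ω ≤ a (n + 1) ω := by
    intro n ω
    simp only [had]
    gcongr
    rw [pi_norm_le_iff_of_nonneg (norm_nonneg _)]
    intro k
    refine le_trans ?_ (norm_le_pi_norm _ k)
    rw [Real.norm_of_nonneg (by positivity), Real.norm_of_nonneg (by positivity), Finset.sum_range_succ]
    nlinarith [sq_nonneg (v n ω k)]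
  have hinv : ∀ (n : Fin N) ω, a (n + 1) (flipAt n ω) = a (n + 1) ω := by
    intro n ω
    simp only [had]
    congr 2
    ext k
    apply Finset.sum_congr rfl
    intro j hj
    rw [Finset.mem_range] at hj
    rw [adapted_flip hv n j (by omega)]
  have hk : ∀ k, ∑ ω, a N ω * (WW (fun j => v j ω k) N ω ^ 2 / a N ω) ^ m ≤
      3 * m ^ 2 * (6 * m) ^ (m - 1) * ∑ ω, a N ω := fun k =>
    scalar_bound m hm (fun j ω => v j ω k) (fun n ω ω' h => by simp only [hv n ω ω' h]) a ha
      (has k) hmono hinv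
  set c : ℝ := 3 * m ^ 2 * (6 * m) ^ (m - 1) with hc
  set θ : ℝ := 60 * m with hθ
  have hθ0 : 0 < θ := by rw [hθ]; positivity
  have hcK : K * c ≤ θ ^ m := by
    have h1 : c = m / 2 * (6 * m) ^ m := by
      obtain ⟨p, rfl⟩ : ∃ p, m = p + 1 := ⟨m - 1, by omega⟩
      rw [hc]; simp only [Nat.add_sub_cancel]; ring
    have h2 : (K : ℝ) ≤ 2 ^ m := by exact_mod_cast hKm
    have h3 : (m : ℝ) ≤ 2 ^ m := by exact_mod_cast (Nat.lt_two_pow_self (n := m)).le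
    calc K * c ≤ 2 ^ m * (2 ^ m * (6 * m) ^ m) := by
          rw [h1]; gcongr; linarith
      _ = (24 * m) ^ m := by rw [← mul_pow, ← mul_pow]; ring_nf
      _ ≤ θ ^ m := by rw [hθ]; gcongr; norm_num
  have hpt : ∀ ω : Fin N → Bool, ‖∑ n : Fin N, rad (ω n) • v (n : ℕ) ω‖ ^ 2 ≤
      θ * a N ω + θ / θ ^ m * ∑ k, a N ω * (WW (fun j => v j ω k) N ω ^ 2 / a N ω) ^ m := by
    intro ω
    have hA := ha N ω
    set B := θ * a N ω + θ / θ ^ m * ∑ k, a N ω * (WW (fun j => v j ω k) N ω ^ 2 / a N ω) ^ m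
    have hB : 0 ≤ B := by
      have : 0 ≤ ∑ k, a N ω * (WW (fun j => v j ω k) N ω ^ 2 / a N ω) ^ m :=
        Finset.sum_nonneg fun k _ => by positivity
      positivity
    suffices h : ‖∑ n : Fin N, rad (ω n) • v (n : ℕ) ω‖ ≤ √B by
      calc _ ≤ √B ^ 2 := by gcongr
        _ = B := Real.sq_sqrt hB
    rw [pi_norm_le_iff_of_nonneg (Real.sqrt_nonneg _)]
    intro k
    rw [fin_sum_eq (fun j => v j ω), Real.norm_eq_abs]
    apply Real.abs_le_sqrt
    have hle : a N ω * (WW (fun j => v j ω k) N ω ^ 2 / a N ω) ^ m ≤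
        ∑ k, a N ω * (WW (fun j => v j ω k) N ω ^ 2 / a N ω) ^ m :=
      Finset.single_le_sum (f := fun k => a N ω * (WW (fun j => v j ω k) N ω ^ 2 / a N ω) ^ m)
        (fun k _ => by positivity) (Finset.mem_univ k)
    have hx : WW (fun j => v j ω k) N ω ^ 2 = a N ω * (WW (fun j => v j ω k) N ω ^ 2 / a N ω) := by
      field_simp
    set t := WW (fun j => v j ω k) N ω ^ 2 / a N ω with ht
    have ht0 : 0 ≤ t := by positivity
    have htt : t ≤ θ + θ / θ ^ m * t ^ m := by
      rcases le_total t θ with h | h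
      · have : 0 ≤ θ / θ ^ m * t ^ m := by positivity
        linarith
      · have h1 : 1 ≤ t / θ := by rwa [one_le_div hθ0]
        have h2 := le_self_pow₀ h1 (show m ≠ 0 by omega)
        have h3 : θ / θ ^ m * t ^ m = θ * (t / θ) ^ m := by
          clear_value t
          rw [div_pow]; ring
        have h4 : t = θ * (t / θ) := by field_simp
        rw [h3]
        nlinarith
    calc WW (fun j => v j ω k) N ω ^ 2 = a N ω * t := hx
      _ ≤ a N ω * (θ + θ / θ ^ m * t ^ m) := by gcongr
      _ = θ * a N ω + θ / θ ^ m * (a N ω * t ^ m) := by ring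
      _ ≤ B := by simp only [B]; gcongr
  have hsumA : 0 ≤ ∑ ω, a N ω := Finset.sum_nonneg fun ω _ => (ha N ω).le
  calc _ ≤ ∑ ω : Fin N → Bool, (θ * a N ω + θ / θ ^ m * ∑ k, a N ω * (WW (fun j => v j ω k) N ω ^ 2 / a N ω) ^ m) :=
        Finset.sum_le_sum fun ω _ => hpt ω
    _ = θ * ∑ ω, a N ω + θ / θ ^ m * ∑ k, ∑ ω, a N ω * (WW (fun j => v j ω k) N ω ^ 2 / a N ω) ^ m := by
        rw [Finset.sum_add_distrib, ← Finset.mul_sum, ← Finset.mul_sum, Finset.sum_comm]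
    _ ≤ θ * ∑ ω, a N ω + θ / θ ^ m * ∑ k : Fin K, (c * ∑ ω, a N ω) := by
        gcongr with k _
        exact hk k
    _ = θ * ∑ ω, a N ω + θ / θ ^ m * (K * c) * ∑ ω, a N ω := by
        simp; ring
    _ ≤ θ * ∑ ω, a N ω + θ / θ ^ m * (θ ^ m) * ∑ ω, a N ω := by gcongr
    _ = 120 * m * ∑ ω, a N ω := by
        rw [div_mul_cancel₀ _ (by positivity), hθ]; ring

lemma upper_real {N K : ℕ} (m : ℕ) (hm : 2 ≤ m) (hKm : K ≤ 2 ^ m)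
    (v : ℕ → (Fin N → Bool) → Fin K → ℝ) (hv : DyadicAdapted v) :
    ∑ ω : Fin N → Bool, ‖∑ n : Fin N, rad (ω n) • v (n : ℕ) ω‖ ^ 2 ≤
      120 * m * ∑ ω : Fin N → Bool, ‖fun k => ∑ j ∈ Finset.range N, v j ω k ^ 2‖ := by
  apply le_of_forall_pos_le_add
  intro δ hδ
  have hm' : (2 : ℝ) ≤ m := by exact_mod_cast hm
  have h := upper_real_eps m hm hKm v hv (δ / (120 * m * 2 ^ N)) (by positivity)
  rw [Finset.sum_add_distrib] at h
  refine h.trans (le_of_eq ?_)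
  simp
  field_simp
  ring

lemma square_le {N K : ℕ} (v : ℕ → Fin K → ℝ) :
    2 ^ N * ‖fun k => ∑ j ∈ Finset.range N, v j k ^ 2‖ ≤
      ∑ ω : Fin N → Bool, ‖∑ n : Fin N, rad (ω n) • v (n : ℕ)‖ ^ 2 := by
  rw [← le_div_iff₀' (by positivity), pi_norm_le_iff_of_nonneg (by positivity)]
  intro k
  rw [le_div_iff₀' (by positivity), Real.norm_of_nonneg (by positivity), ← WW_orth (N := N) (fun j => v j k) N le_rfl]
  apply Finset.sum_le_sum
  intro ω _
  rw [← fin_sum_eq v, ← sq_abs, ← Real.norm_eq_abs]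
  gcongr
  exact norm_le_pi_norm _ k

lemma upper_real' {N K : ℕ} (m : ℕ) (hm : 2 ≤ m) (hKm : K ≤ 2 ^ m)
    (v : ℕ → (Fin N → Bool) → Fin K → ℝ) (hv : DyadicAdapted v) :
    (∑ ω : Fin N → Bool, ‖∑ n : Fin N, rad (ω n) • v (n : ℕ) ω‖ ^ 2) / 2 ^ N ≤
      120 * m * ((∑ ω : Fin N → Bool, ∑ ω' : Fin N → Bool,
        ‖∑ n : Fin N, rad (ω' n) • v (n : ℕ) ω‖ ^ 2) / (2 ^ N * 2 ^ N)) := by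
  have h1 := upper_real m hm hKm v hv
  have h2 : ∑ ω : Fin N → Bool, 2 ^ N * ‖fun k => ∑ j ∈ Finset.range N, v j ω k ^ 2‖ ≤ _ :=
    Finset.sum_le_sum fun ω _ => square_le (N := N) (fun j => v j ω)
  rw [← Finset.mul_sum] at h2
  rw [div_le_iff₀ (by positivity)]
  refine h1.trans ?_
  rw [mul_assoc (120 * (m:ℝ))]
  apply mul_le_mul_of_nonneg_left _ (by positivity)
  rw [← le_div_iff₀' (by positivity)] at h2
  refine h2.trans (le_of_eq ?_)
  field_simp

lemma lint_bern {N : ℕ} (f : (Fin N → Bool) → ℝ≥0∞) :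
    ∫⁻ ω, f ω ∂(bern N) = ∑ ω, f ω * (2 ^ N)⁻¹ := by
  rw [lintegral_fintype]
  apply Finset.sum_congr rfl
  intro ω _
  congr 1
  unfold bern
  rw [Measure.pi_singleton]
  have : ∀ b : Bool, unifBool {b} = 2⁻¹ := by
    intro b
    cases b <;> simp [unifBool]
  simp [this, ENNReal.inv_pow]

lemma ofReal_avg {N : ℕ} (g : (Fin N → Bool) → ℝ) (hg : ∀ ω, 0 ≤ g ω) :
    ∫⁻ ω, ENNReal.ofReal (g ω) ∂(bern N) = ENNReal.ofReal ((∑ ω, g ω) / 2 ^ N) := by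
  rw [lint_bern, ← Finset.sum_mul, ← ENNReal.ofReal_sum_of_nonneg (fun ω _ => hg ω),
    div_eq_mul_inv, ENNReal.ofReal_mul (Finset.sum_nonneg fun ω _ => hg ω),
    ENNReal.ofReal_inv_of_pos (by positivity), ENNReal.ofReal_pow (by norm_num)]
  simp

lemma eLp_eq {α X : Type*} [MeasurableSpace α] [NormedAddCommGroup X] (μ : Measure α) (f : α → X)
    (A : ℝ) (h : ∫⁻ x, ENNReal.ofReal (‖f x‖ ^ 2) ∂μ = ENNReal.ofReal A) :
    eLpNorm f (ENNReal.ofReal 2) μ = ENNReal.ofReal (√A) := by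
  rw [eLpNorm_eq_lintegral_rpow_enorm_toReal (by simp) (by simp)]
  have : ∀ x, ‖f x‖ₑ ^ (ENNReal.ofReal 2).toReal = ENNReal.ofReal (‖f x‖ ^ 2) := by
    intro x
    rw [ENNReal.ofReal_pow (norm_nonneg _), ofReal_norm, ENNReal.toReal_ofReal (by norm_num)]
    exact ENNReal.rpow_two _
  simp only [this, h]
  rw [ENNReal.toReal_ofReal (by norm_num)]
  rcases le_total 0 A with hA | hA
  · rw [ENNReal.ofReal_rpow_of_nonneg hA (by norm_num), Real.sqrt_eq_rpow]
  · rw [ENNReal.ofReal_of_nonpos hA, Real.sqrt_eq_zero_of_nonpos hA]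
    simp

lemma eLp_bern {N : ℕ} {X : Type*} [NormedAddCommGroup X] (f : (Fin N → Bool) → X) :
    eLpNorm f (ENNReal.ofReal 2) (bern N) = ENNReal.ofReal (√((∑ ω, ‖f ω‖ ^ 2) / 2 ^ N)) :=
  eLp_eq _ _ _ (ofReal_avg _ fun _ => by positivity)

lemma eLp_bern2 {N : ℕ} {X : Type*} [NormedAddCommGroup X]
    (f : (Fin N → Bool) × (Fin N → Bool) → X) :
    eLpNorm f (ENNReal.ofReal 2) ((bern N).prod (bern N)) =
      ENNReal.ofReal (√((∑ ω, ∑ ω', ‖f (ω, ω')‖ ^ 2) / (2 ^ N * 2 ^ N))) := by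
  apply eLp_eq
  rw [lintegral_prod _ (measurable_of_finite _).aemeasurable]
  have h : ∀ ω, ∫⁻ ω', ENNReal.ofReal (‖f (ω, ω')‖ ^ 2) ∂(bern N) =
      ENNReal.ofReal ((∑ ω', ‖f (ω, ω')‖ ^ 2) / 2 ^ N) := fun ω =>
    ofReal_avg (fun ω' => ‖f (ω, ω')‖ ^ 2) (fun _ => by positivity)
  simp only [h]
  rw [ofReal_avg _ (fun _ => by positivity), ← Finset.sum_div, div_div]

lemma upper_final (K : ℕ) (hK : 1 ≤ K) :
    Dp 2 (Fin K → ℝ) ≤ ENNReal.ofReal (16 * √(1 + Real.log K)) := by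
  apply sInf_le
  intro N hN v hv
  have hKr : (1 : ℝ) ≤ K := by exact_mod_cast hK
  have hlog : 0 ≤ Real.log K := Real.log_nonneg hKr
  set m := Nat.log 2 K + 2 with hm
  have hKm : K ≤ 2 ^ m := by
    have := Nat.lt_pow_succ_log_self (b := 2) (by norm_num) K
    refine this.le.trans (Nat.pow_le_pow_right (by norm_num) (by omega))
  have hmb : (m : ℝ) ≤ 2 * (1 + Real.log K) := by
    have h1 : 2 ^ Nat.log 2 K ≤ K := Nat.pow_log_le_self 2 (by omega)
    have h2 : ((2:ℝ) ^ Nat.log 2 K) ≤ K := by exact_mod_cast h1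
    have h3 := Real.log_le_log (by positivity) h2
    rw [Real.log_pow] at h3
    have := Real.log_two_gt_d9
    rw [hm]; push_cast
    have : (0:ℝ) ≤ Nat.log 2 K := by positivity
    nlinarith
  rw [eLp_bern, eLp_bern2, ← ENNReal.ofReal_mul (by positivity)]
  apply ENNReal.ofReal_le_ofReal
  have h := upper_real' m (by omega) hKm v hv
  set L := (∑ ω : Fin N → Bool, ‖∑ n : Fin N, rad (ω n) • v (n : ℕ) ω‖ ^ 2) / 2 ^ N
  set R := (∑ ω : Fin N → Bool, ∑ ω' : Fin N → Bool,
        ‖∑ n : Fin N, rad (ω' n) • v (n : ℕ) ω‖ ^ 2) / (2 ^ N * 2 ^ N)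
  have hR : 0 ≤ R := by positivity
  calc √L ≤ √((16 : ℝ) ^ 2 * (1 + Real.log K) * R) := by
        apply Real.sqrt_le_sqrt
        refine h.trans (mul_le_mul_of_nonneg_right ?_ hR)
        linarith
    _ = 16 * √(1 + Real.log K) * √R := by
        rw [Real.sqrt_mul (by positivity), Real.sqrt_mul (by positivity), Real.sqrt_sq (by norm_num)]

/-- the extremal example -/
def exv {N K : ℕ} (κ : Fin K → Fin N → Bool) (n : ℕ) (ω : Fin N → Bool) (k : Fin K) : ℝ :=
  open Classical in if ∀ i : Fin N, (i : ℕ) < n → κ k i = ω i then rr n (κ k) else 0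

lemma exv_adapted {N K : ℕ} (κ : Fin K → Fin N → Bool) : DyadicAdapted (exv κ) := by
  intro n ω ω' h
  funext k
  unfold exv
  have : (∀ i : Fin N, (i : ℕ) < n → κ k i = ω i) ↔ (∀ i : Fin N, (i : ℕ) < n → κ k i = ω' i) :=
    forall_congr' fun i => imp_congr_right fun hi => by rw [h i hi]
  simp only [this]

lemma abs_rr_le {N : ℕ} (n : ℕ) (ω : Fin N → Bool) : |rr n ω| ≤ 1 := by
  unfold rr
  split_ifs
  · rw [rad_abs]
  · simp

lemma exv_bound {N K : ℕ} (κ : Fin K → Fin N → Bool) (ω ω' : Fin N → Bool) (k : Fin K) :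
    |WW (fun j => exv κ j ω k) N ω'| ≤ MX (fun j => rr j ω) N ω' + 1 := by
  have key : ∀ n, n ≤ N →
      ((∀ i : Fin N, (i : ℕ) < n → κ k i = ω i) →
        WW (fun j => exv κ j ω k) n ω' = WW (fun j => rr j ω) n ω') ∧
      |WW (fun j => exv κ j ω k) n ω'| ≤ MX (fun j => rr j ω) N ω' + 1 := by
    intro n
    induction n with
    | zero =>
      intro _
      have := MX_nonneg (fun j => rr j ω) N ω'
      refine ⟨fun _ => by simp [WW], ?_⟩
      simp [WW]; linarith
    | succ n ih =>
      intro hn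
      obtain ⟨i1, i2⟩ := ih (by omega)
      constructor
      · intro h
        have h' : ∀ i : Fin N, (i : ℕ) < n → κ k i = ω i := fun i hi => h i (by omega)
        rw [WW_succ, WW_succ, i1 h']
        congr 2
        unfold exv
        rw [if_pos h']
        unfold rr
        simp only [show n < N by omega, dif_pos]
        rw [h ⟨n, by omega⟩ (by simp)]
      · rw [WW_succ]
        by_cases h' : ∀ i : Fin N, (i : ℕ) < n → κ k i = ω i
        · rw [i1 h']
          have e1 : |exv κ n ω k| ≤ 1 := by
            unfold exv
            rw [if_pos h']
            exact abs_rr_le _ _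
          have e2 := abs_rr_le n ω'
          have e3 : |rr n ω' * exv κ n ω k| ≤ 1 := by
            rw [abs_mul]
            exact mul_le_one₀ e2 (abs_nonneg _) e1
          have e4 := WW_le_MX (fun j => rr j ω) n ω'
          have e5 := MX_mono (fun j => rr j ω) ω' (show n ≤ N by omega)
          have e6 := abs_add_le (WW (fun j => rr j ω) n ω') (rr n ω' * exv κ n ω k)
          simp only at e5
          linarith
        · have : exv κ n ω k = 0 := by
            unfold exv
            rw [if_neg h']
          rw [this]
          simpa using i2
  exact (key N le_rfl).2

lemma exv_num {N K : ℕ} (κ : Fin K → Fin N → Bool) (hκ : Function.Surjective κ) (ω : Fin N → Bool) :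
    (N : ℝ) ≤ ‖∑ n : Fin N, rad (ω n) • exv κ (n : ℕ) ω‖ := by
  obtain ⟨k, hk⟩ := hκ ω
  have h := norm_le_pi_norm (∑ n : Fin N, rad (ω n) • exv κ (n : ℕ) ω) k
  rw [fin_sum_eq (fun j => exv κ j ω)] at h
  refine le_trans ?_ h
  have : WW (fun j => exv κ j ω k) N ω = N := by
    unfold WW
    rw [Finset.sum_congr rfl (g := fun _ => (1:ℝ))]
    · simp
    · intro j hj
      rw [Finset.mem_range] at hj
      simp only [exv, hk]
      rw [if_pos (fun _ _ => trivial), ← sq, rr_sq j hj]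
  rw [this]
  exact Real.le_norm_self _

lemma exv_den {N K : ℕ} (hN : 1 ≤ N) (κ : Fin K → Fin N → Bool) (ω : Fin N → Bool) :
    ∑ ω' : Fin N → Bool, ‖∑ n : Fin N, rad (ω' n) • exv κ (n : ℕ) ω‖ ^ 2 ≤ 10 * N * 2 ^ N := by
  have hN' : (1 : ℝ) ≤ N := by exact_mod_cast hN
  have h1 : ∀ ω' : Fin N → Bool, ‖∑ n : Fin N, rad (ω' n) • exv κ (n : ℕ) ω‖ ^ 2 ≤
      2 * MX (fun j => rr j ω) N ω' ^ 2 + 2 := by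
    intro ω'
    have h0 := MX_nonneg (fun j => rr j ω) N ω'
    have : ‖∑ n : Fin N, rad (ω' n) • exv κ (n : ℕ) ω‖ ≤ MX (fun j => rr j ω) N ω' + 1 := by
      rw [pi_norm_le_iff_of_nonneg (by linarith)]
      intro k
      rw [fin_sum_eq (fun j => exv κ j ω)]
      exact exv_bound κ ω ω' k
    have h2 := norm_nonneg (∑ n : Fin N, rad (ω' n) • exv κ (n : ℕ) ω)
    nlinarith [sq_nonneg (MX (fun j => rr j ω) N ω' - 1)]
  have h2 := doob (N := N) (fun j => rr j ω)
  have h3 : ∑ j ∈ Finset.range N, rr j ω ^ 2 = N := by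
    rw [Finset.sum_congr rfl (g := fun _ => (1:ℝ))]
    · simp
    · intro j hj
      rw [Finset.mem_range] at hj
      exact rr_sq j hj ω
  rw [h3] at h2
  refine (Finset.sum_le_sum fun ω' _ => h1 ω').trans ?_
  rw [Finset.sum_add_distrib, ← Finset.mul_sum]
  have h4 : ∑ ω' : Fin N → Bool, (2:ℝ) = 2 ^ N * 2 := by simp
  rw [h4]
  have : (0:ℝ) < 2 ^ N := by positivity
  nlinarith

lemma dec_lower {N K : ℕ} (hN : 2 ≤ N) (v : ℕ → (Fin N → Bool) → Fin K → ℝ) (hv : DyadicAdapted v)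
    (A B : ℝ) (hB : 0 < B)
    (h1 : ∀ ω : Fin N → Bool, A ≤ ‖∑ n : Fin N, rad (ω n) • v (n : ℕ) ω‖ ^ 2)
    (h2 : ∀ ω : Fin N → Bool,
      ∑ ω' : Fin N → Bool, ‖∑ n : Fin N, rad (ω' n) • v (n : ℕ) ω‖ ^ 2 ≤ B * 2 ^ N) :
    ENNReal.ofReal (√(A / B)) ≤ Dp 2 (Fin K → ℝ) := by
  apply le_sInf
  intro c hc
  have h := hc N hN v hv
  rw [eLp_bern, eLp_bern2] at h
  have e1 : A ≤ (∑ ω : Fin N → Bool, ‖∑ n : Fin N, rad (ω n) • v (n : ℕ) ω‖ ^ 2) / 2 ^ N := by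
    rw [le_div_iff₀ (by positivity)]
    calc A * 2 ^ N = ∑ ω : Fin N → Bool, A := by simp; ring
      _ ≤ _ := Finset.sum_le_sum fun ω _ => h1 ω
  have e2 : (∑ ω : Fin N → Bool, ∑ ω' : Fin N → Bool,
        ‖∑ n : Fin N, rad (ω' n) • v (n : ℕ) ω‖ ^ 2) / (2 ^ N * 2 ^ N) ≤ B := by
    rw [div_le_iff₀ (by positivity)]
    calc _ ≤ ∑ ω : Fin N → Bool, B * 2 ^ N := Finset.sum_le_sum fun ω _ => h2 ω
      _ = _ := by simp; ring
  have h3 : ENNReal.ofReal √A ≤ c * ENNReal.ofReal √B :=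
    (ENNReal.ofReal_le_ofReal (Real.sqrt_le_sqrt e1)).trans (h.trans (by
      gcongr))
  rw [Real.sqrt_div' _ hB.le, ENNReal.ofReal_div_of_pos (Real.sqrt_pos.2 hB)]
  exact ENNReal.div_le_of_le_mul h3

lemma lower_final (K : ℕ) (hK : 1 ≤ K) :
    ENNReal.ofReal (1 / 16 * √(1 + Real.log K)) ≤ Dp 2 (Fin K → ℝ) := by
  have hKr : (1 : ℝ) ≤ K := by exact_mod_cast hK
  have hlog : 0 ≤ Real.log K := Real.log_nonneg hKr
  have e16 : 1 / 16 * √(1 + Real.log K) = √((1 + Real.log K) / 16 ^ 2) := by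
    rw [Real.sqrt_div' _ (by norm_num), Real.sqrt_sq (by norm_num)]; ring
  rw [e16]
  have hlog2 : Real.log K ≤ Nat.log 2 K + 1 := by
    have h1 := (Nat.lt_pow_succ_log_self (b := 2) (by norm_num) K).le
    have h2 : (K : ℝ) ≤ 2 ^ (Nat.log 2 K + 1) := by exact_mod_cast h1
    have h3 := Real.log_le_log (by positivity) h2
    rw [Real.log_pow] at h3
    push_cast at h3
    have := Real.log_two_lt_d9
    have : (0:ℝ) ≤ Nat.log 2 K := by positivity
    nlinarith
  by_cases hN : 2 ≤ Nat.log 2 K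
  · set N := Nat.log 2 K with hNd
    have hcard : 2 ^ N ≤ K := Nat.pow_log_le_self 2 (by omega)
    obtain ⟨κ, hκ⟩ : ∃ κ : Fin K → Fin N → Bool, Function.Surjective κ := by
      have : Nonempty ((Fin N → Bool) ↪ Fin K) := by
        apply Function.Embedding.nonempty_of_card_le
        simpa using hcard
      obtain ⟨e⟩ := this
      exact ⟨Function.invFun e, Function.invFun_surjective e.injective⟩
    have hNr : (2 : ℝ) ≤ N := by exact_mod_cast hN
    refine le_trans (ENNReal.ofReal_le_ofReal (Real.sqrt_le_sqrt ?_))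
      (dec_lower hN (exv κ) (exv_adapted κ) (N ^ 2) (10 * N) (by positivity)
        (fun ω => by have := exv_num κ hκ ω; gcongr) (exv_den (by omega) κ))
    have : (N:ℝ) ^ 2 / (10 * N) = N / 10 := by field_simp
    rw [this]
    linarith
  · have hl : (Nat.log 2 K : ℝ) ≤ 1 := by
      have : Nat.log 2 K ≤ 1 := by omega
      exact_mod_cast this
    have : Nonempty (Fin K) := ⟨⟨0, by omega⟩⟩
    have hn : ∀ ω : Fin 2 → Bool,
        ‖∑ n : Fin 2, rad (ω n) • (if (n:ℕ) = 0 then (fun _ => 1 : Fin K → ℝ) else 0)‖ = 1 := by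
      intro ω
      rw [Fin.sum_univ_two]
      simp [norm_smul, rad_abs, pi_norm_const]
    refine le_trans (ENNReal.ofReal_le_ofReal (Real.sqrt_le_sqrt ?_))
      (dec_lower (N := 2) le_rfl (fun n _ => if n = 0 then (fun _ => 1) else 0)
        (fun _ _ _ _ => rfl) 1 1 one_pos (fun ω => by rw [hn]; simp) (fun ω => by
          simp only [hn]; simp; norm_num))
    linarith

theorem asymptotics_of_dyadic_decoupling_in_ell_infty :
    ∃ c : ℝ, 1 ≤ c ∧ ∀ K : ℕ, 1 ≤ K →
      ENNReal.ofReal ((1 / c) * Real.sqrt (1 + Real.log K)) ≤ Dp 2 (Fin K → ℝ) ∧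
      Dp 2 (Fin K → ℝ) ≤ ENNReal.ofReal (c * Real.sqrt (1 + Real.log K)) := by
  exact ⟨16, by norm_num, fun K hK => ⟨lower_final K hK, upper_final K hK⟩⟩
end
end

section
/- Let (Ω,F,ℙ) be a divisible probability space, X a separable Banach space, F ∈ F an event, and let μ be a Borel probability measure on X of the form μ = Σ_{k=1}^n α_k δ_{x_k} for some n ∈ ℕ, α₁,…,α_n ∈ (0,1), and distinct x₁,…,x_n ∈ X. Let G ⊆ F be a σ-algebra generated by a finite partition (A_i)_{i=1}^k of Ω with ℙ(A_i) > 0 for all i. Then there exists an F-measurable, μ-distributed random variable φ that is independent of G, together with sets H₁, H₂ ∈ σ(G,φ) satisfying H₁ ⊆ F ⊆ H₂ and ℙ(H₂∖H₁) ≤ (max_{j∈{1,…,n}} α_j) · min{ ℙ(G₂∖G₁) : G₁, G₂ ∈ G, G₁ ⊆ F ⊆ G₂ }. -/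
open MeasureTheory ProbabilityTheory Filter Set
open scoped ENNReal NNReal Topology

noncomputable section

/-- A probability space is divisible if every event can be split in any proportion. -/
def Divisible {Ω : Type*} {m0 : MeasurableSpace Ω} (μ : Measure Ω) : Prop :=
  ∀ A : Set Ω, MeasurableSet A → ∀ θ : ℝ, θ ∈ Set.Ioo (0 : ℝ) 1 →
    ∃ B : Set Ω, MeasurableSet B ∧ B ⊆ A ∧ μ B = ENNReal.ofReal θ * μ A


theorem divisible_exists_subset {Ω : Type*} {m0 : MeasurableSpace Ω} (μ : Measure Ω)
    [IsProbabilityMeasure μ] (hdiv : Divisible μ) (A : Set Ω) (hA : MeasurableSet A)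
    (c : ℝ≥0∞) (hc : c ≤ μ A) : ∃ B : Set Ω, MeasurableSet B ∧ B ⊆ A ∧ μ B = c := by
  rcases eq_or_ne c 0 with h0 | h0
  · exact ⟨∅, MeasurableSet.empty, empty_subset _, by simp [h0]⟩
  rcases eq_or_lt_of_le hc with h1 | h1
  · exact ⟨A, hA, subset_rfl, h1.symm⟩
  have hA0 : μ A ≠ 0 := fun h => by simp [h] at h1
  have hAt : μ A ≠ ∞ := measure_ne_top _ _
  have hlt : c / μ A < 1 := by
    rw [ENNReal.div_lt_iff (Or.inl hA0) (Or.inl hAt)]; simpa using h1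
  have hpos : 0 < c / μ A := ENNReal.div_pos h0 hAt
  have hfin : c / μ A ≠ ∞ := (hlt.trans ENNReal.one_lt_top).ne
  obtain ⟨B, hB, hBA, hμ⟩ := hdiv A hA (c / μ A).toReal
    ⟨ENNReal.toReal_pos hpos.ne' hfin, by
      have := (ENNReal.toReal_lt_toReal hfin ENNReal.one_ne_top).2 hlt
      simpa using this⟩
  refine ⟨B, hB, hBA, ?_⟩
  rw [hμ, ENNReal.ofReal_toReal hfin, ENNReal.div_mul_cancel hA0 hAt]

theorem divisible_exists_partition {Ω : Type*} {m0 : MeasurableSpace Ω} (μ : Measure Ω)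
    [IsProbabilityMeasure μ] (hdiv : Divisible μ) (F : Set Ω) (hF : MeasurableSet F) (n : ℕ) :
    ∀ (A : Set Ω), MeasurableSet A → ∀ c : Fin (n + 1) → ℝ≥0∞, ∑ j, c j = μ A →
    ∃ B : Fin (n + 1) → Set Ω, (∀ j, MeasurableSet (B j)) ∧
      Pairwise (Function.onFun Disjoint B) ∧ (⋃ j, B j) = A ∧ (∀ j, μ (B j) = c j) ∧
      ∃ j0, ∀ j, j ≠ j0 → B j ⊆ F ∨ Disjoint (B j) F := by
  induction n with
  | zero =>
    intro A hA c hc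
    haveI : Subsingleton (Fin (0 + 1)) := inferInstanceAs (Subsingleton (Fin 1))
    refine ⟨fun _ => A, fun _ => hA, ?_, ?_, ?_, 0, ?_⟩
    · intro i j hij; exact absurd (Subsingleton.elim i j) hij
    · simp [iUnion_const]
    · intro j
      rw [Subsingleton.elim j 0, ← hc]; simp
    · intro j hj; exact absurd (Subsingleton.elim j 0) hj
  | succ n ih =>
    intro A hA c hc
    rw [Fin.sum_univ_succ] at hc
    have hc0 : c 0 ≤ μ A := hc ▸ le_self_add
    have hc0t : c 0 ≠ ∞ := ne_top_of_le_ne_top (measure_ne_top _ _) hc0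
    -- a general step
    have step : ∀ B0 : Set Ω, MeasurableSet B0 → B0 ⊆ A → μ B0 = c 0 →
        (B0 ⊆ F ∨ Disjoint (A \ B0) F) →
        ∃ B : Fin (n + 1 + 1) → Set Ω, (∀ j, MeasurableSet (B j)) ∧
          Pairwise (Function.onFun Disjoint B) ∧ (⋃ j, B j) = A ∧ (∀ j, μ (B j) = c j) ∧
          ∃ j0, ∀ j, j ≠ j0 → B j ⊆ F ∨ Disjoint (B j) F := by
      intro B0 hB0 hB0A hμ hor
      have hrest : ∑ j : Fin (n + 1), c j.succ = μ (A \ B0) := by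
        rw [measure_sdiff hB0A hB0.nullMeasurableSet (measure_ne_top _ _), hμ, ← hc]
        exact (ENNReal.add_sub_cancel_left hc0t).symm
      obtain ⟨B, hBm, hBd, hBu, hBμ, j0, hj0⟩ :=
        ih (A \ B0) (hA.diff hB0) (fun j => c j.succ) hrest
      have hsub : ∀ j, B j ⊆ A \ B0 := fun j => hBu ▸ subset_iUnion B j
      have hd0 : ∀ j, Disjoint B0 (B j) := fun j =>
        (disjoint_sdiff_right (s := B0) (t := A)).mono_right (hsub j)
      refine ⟨Fin.cons B0 B, ?_, ?_, ?_, ?_, ?_⟩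
      · intro j; refine Fin.cases ?_ (fun j => ?_) j
        · simpa using hB0
        · simpa using hBm j
      · intro i j
        refine Fin.cases ?_ (fun i => ?_) i <;> refine Fin.cases ?_ (fun j => ?_) j
        · intro h; exact absurd rfl h
        · intro _; simpa [Function.onFun] using hd0 j
        · intro _; simpa [Function.onFun] using (hd0 i).symm
        · intro h
          have : i ≠ j := fun e => h (by rw [e])
          simpa [Function.onFun] using hBd this
      · have : (⋃ j, (Fin.cons B0 B : Fin (n + 1 + 1) → Set Ω) j) = B0 ∪ ⋃ j, B j := by
          ext ω; simp [Fin.exists_fin_succ]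
        rw [this, hBu, union_sdiff_cancel hB0A]
      · intro j; refine Fin.cases ?_ (fun j => ?_) j
        · simpa using hμ
        · simpa using hBμ j
      · rcases hor with h | h
        · refine ⟨j0.succ, fun j => Fin.cases ?_ (fun j => ?_) j⟩
          · intro _; left; simpa using h
          · intro hj
            have : j ≠ j0 := fun e => hj (by rw [e])
            simpa using hj0 j this
        · refine ⟨0, fun j => Fin.cases ?_ (fun j => ?_) j⟩
          · intro hj; exact absurd rfl hj
          · intro _; right; simpa using h.mono_left (hsub j)
    rcases le_total (c 0) (μ (A ∩ F)) with h | h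
    · obtain ⟨B0, hB0, hB0A, hμ⟩ :=
        divisible_exists_subset μ hdiv (A ∩ F) (hA.inter hF) (c 0) h
      exact step B0 hB0 (hB0A.trans inter_subset_left) hμ (Or.inl (hB0A.trans inter_subset_right))
    · have hle : c 0 - μ (A ∩ F) ≤ μ (A \ F) := by
        rw [tsub_le_iff_left, measure_inter_add_sdiff A hF]; exact hc0
      obtain ⟨D, hD, hDA, hμ⟩ :=
        divisible_exists_subset μ hdiv (A \ F) (hA.diff hF) _ hle
      refine step ((A ∩ F) ∪ D) ((hA.inter hF).union hD)
        (union_subset inter_subset_left (hDA.trans sdiff_subset)) ?_ (Or.inr ?_)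
      · rw [measure_union _ hD, hμ, add_tsub_cancel_of_le h]
        rw [Set.disjoint_left]
        intro ω h1 h2; exact (hDA h2).2 h1.2
      · rw [Set.disjoint_left]
        intro ω h1 h2; exact h1.2 (Or.inl ⟨h1.1, h2⟩)

theorem generateFrom_partition_atom {Ω : Type*} {k : ℕ} (A : Fin k → Set Ω)
    (hdisj : Pairwise (Function.onFun Disjoint A)) (S : Set Ω)
    (hS : MeasurableSet[MeasurableSpace.generateFrom (Set.range A)] S) :
    ∀ i, ∀ ω ∈ A i, ∀ ω' ∈ A i, ω ∈ S → ω' ∈ S := by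
  induction S, hS using MeasurableSpace.generateFrom_induction with
  | hC t ht _ =>
    obtain ⟨l, rfl⟩ := ht
    intro i ω hω ω' hω' h
    have : i = l := by
      by_contra hne
      exact Set.disjoint_left.1 (hdisj hne) hω h
    exact this ▸ hω'
  | empty => intro i ω _ ω' _ h; exact h
  | compl t _ ih => intro i ω hω ω' hω' h h'; exact h (ih i ω' hω' ω hω h')
  | iUnion s _ ih =>
    intro i ω hω ω' hω' h
    obtain ⟨m, hm⟩ := mem_iUnion.1 h
    exact mem_iUnion.2 ⟨m, ih m i ω hω ω' hω' hm⟩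

/-- On a divisible probability space, given a finitely supported law `μX` and a σ-algebra `G`
generated by a finite partition, there is a `μX`-distributed random variable `φ`
independent of `G` such that any event `F` can be approximated from inside and outside by
`σ(G,φ)`-events, shrinking the defect by the factor `max αⱼ`. -/
theorem approx_event_by_independent_discrete_rv
    {Ω : Type*} {m0 : MeasurableSpace Ω} (μ : Measure Ω) [IsProbabilityMeasure μ]
    (hdiv : Divisible μ)
    {X : Type*} [MeasurableSpace X] [NormedAddCommGroup X] [NormedSpace ℝ X]
    [BorelSpace X] [TopologicalSpace.SeparableSpace X] [CompleteSpace X]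
    (F : Set Ω) (hF : MeasurableSet F)
    (n : ℕ) (hn : 0 < n) (α : Fin n → ℝ) (x : Fin n → X)
    (hα : ∀ j, α j ∈ Set.Ioo (0 : ℝ) 1) (hx : Function.Injective x)
    (μX : Measure X) [IsProbabilityMeasure μX]
    (hμX : μX = ∑ j : Fin n, ENNReal.ofReal (α j) • Measure.dirac (x j))
    (k : ℕ) (hk : 0 < k) (A : Fin k → Set Ω) (hAmeas : ∀ i, MeasurableSet (A i))
    (hdisj : Pairwise (Function.onFun Disjoint A)) (hcover : (⋃ i, A i) = Set.univ)
    (hpos : ∀ i, 0 < μ (A i))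
    (G : MeasurableSpace Ω) (hG : G = MeasurableSpace.generateFrom (Set.range A)) :
    ∃ φ : Ω → X, Measurable[m0] φ ∧ @Measure.map Ω X m0 _ φ μ = μX ∧
      Indep (MeasurableSpace.comap φ inferInstance) G μ ∧
      ∃ H₁ H₂ : Set Ω,
        MeasurableSet[G ⊔ MeasurableSpace.comap φ inferInstance] H₁ ∧
        MeasurableSet[G ⊔ MeasurableSpace.comap φ inferInstance] H₂ ∧
        H₁ ⊆ F ∧ F ⊆ H₂ ∧
        μ (H₂ \ H₁) ≤ (⨆ j, ENNReal.ofReal (α j)) *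
          sInf {m : ℝ≥0∞ | ∃ G₁ G₂ : Set Ω, MeasurableSet[G] G₁ ∧ MeasurableSet[G] G₂ ∧
            G₁ ⊆ F ∧ F ⊆ G₂ ∧ m = μ (G₂ \ G₁)} := by
  classical
  obtain ⟨n, rfl⟩ : ∃ m, n = m + 1 := ⟨n - 1, by omega⟩
  have hsum : ∑ j, ENNReal.ofReal (α j) = 1 := by
    have h1 : μX univ = 1 := measure_univ
    rw [hμX] at h1
    simpa using h1
  have hpart := fun i => @divisible_exists_partition Ω m0 μ _ hdiv F hF n (A i) (hAmeas i)
    (fun j => ENNReal.ofReal (α j) * μ (A i)) (by rw [← Finset.sum_mul, hsum, one_mul])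
  choose C hCm hCd hCu hCμ j0 hj0 using hpart
  have hCA : ∀ i j, C i j ⊆ A i := fun i j => hCu i ▸ subset_iUnion (C i) j
  have hex : ∀ ω, ∃ p : Fin k × Fin (n + 1), ω ∈ C p.1 p.2 := by
    intro ω
    have : ω ∈ ⋃ i, A i := hcover ▸ mem_univ ω
    obtain ⟨i, hi⟩ := mem_iUnion.1 this
    rw [← hCu i] at hi
    obtain ⟨j, hj⟩ := mem_iUnion.1 hi
    exact ⟨(i, j), hj⟩
  choose P hP using hex
  have hA1 : ∀ i l ω, ω ∈ A i → ω ∈ A l → i = l := by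
    intro i l ω h1 h2
    by_contra hne
    exact Set.disjoint_left.1 (hdisj hne) h1 h2
  have hC1 : ∀ i j l ω, ω ∈ C i j → ω ∈ C i l → j = l := by
    intro i j l ω h1 h2
    by_contra hne
    exact Set.disjoint_left.1 (hCd i hne) h1 h2
  have hPu : ∀ i j ω, ω ∈ C i j → P ω = (i, j) := by
    intro i j ω h
    have h1 : (P ω).1 = i := hA1 _ _ ω (hCA _ _ (hP ω)) (hCA _ _ h)
    have h2 := hP ω
    rw [h1] at h2
    exact Prod.ext h1 (hC1 _ _ _ ω h2 h)
  set φ : Ω → X := fun ω => x (P ω).2 with hφ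
  have hcell : ∀ i (s : Set X), φ ⁻¹' s ∩ A i = ⋃ j ∈ Finset.univ.filter (fun j => x j ∈ s), C i j := by
    intro i s
    ext ω
    simp only [mem_inter_iff, mem_preimage, mem_iUnion, Finset.mem_filter, Finset.mem_univ,
      true_and, exists_prop]
    constructor
    · rintro ⟨h1, h2⟩
      have h3 := hP ω
      have h4 : (P ω).1 = i := hA1 _ _ ω (hCA _ _ h3) h2
      exact ⟨(P ω).2, h1, h4 ▸ h3⟩
    · rintro ⟨j, h1, h2⟩
      refine ⟨?_, hCA _ _ h2⟩
      simp only [hφ, hPu i j ω h2]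
      exact h1
  have hpre : ∀ s : Set X, φ ⁻¹' s = ⋃ i, φ ⁻¹' s ∩ A i := by
    intro s
    rw [← inter_iUnion, hcover, inter_univ]
  have hcellm : ∀ i (s : Set X), MeasurableSet[m0] (φ ⁻¹' s ∩ A i) := by
    intro i s
    rw [hcell]
    exact @Finset.measurableSet_biUnion _ _ m0 _ _ (fun j _ => hCm i j)
  have hφm : Measurable[m0] φ := by
    intro s _
    rw [hpre]
    exact MeasurableSet.iUnion (fun i => hcellm i s)
  have hXs : ∀ s : Set X, MeasurableSet s →
      μX s = ∑ j ∈ Finset.univ.filter (fun j => x j ∈ s), ENNReal.ofReal (α j) := by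
    intro s hs
    rw [hμX, Finset.sum_filter]
    simp [Measure.dirac_apply' _ hs, Set.indicator_apply]
  have hkey : ∀ i (s : Set X), MeasurableSet s → μ (φ ⁻¹' s ∩ A i) = μX s * μ (A i) := by
    intro i s hs
    rw [hcell, measure_biUnion_finset (fun a _ b _ hab => hCd i hab) (fun j _ => hCm i j),
      hXs s hs, Finset.sum_mul]
    exact Finset.sum_congr rfl (fun j _ => hCμ i j)
  have hAsum : ∑ i, μ (A i) = 1 := by
    have := measure_iUnion (μ := μ) hdisj hAmeas
    rw [hcover, measure_univ, tsum_fintype] at this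
    exact this.symm
  have hlaw : ∀ s : Set X, MeasurableSet s → μ (φ ⁻¹' s) = μX s := by
    intro s hs
    rw [hpre s, measure_iUnion _ (fun i => hcellm i s), tsum_fintype,
      Finset.sum_congr rfl (fun i _ => hkey i s hs), ← Finset.mul_sum, hAsum, mul_one]
    intro a b hab
    exact (hdisj hab).mono inter_subset_right inter_subset_right
  have hGle : G ≤ m0 := by
    rw [hG]
    apply MeasurableSpace.generateFrom_le
    rintro _ ⟨i, rfl⟩
    exact hAmeas i
  have hCG : ∀ i j,
      MeasurableSet[G ⊔ MeasurableSpace.comap φ inferInstance] (C i j) := by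
    intro i j
    have h1 : C i j = φ ⁻¹' {x j} ∩ A i := by
      rw [hcell]
      ext ω
      simp [hx.eq_iff]
    rw [h1]
    have h2 : MeasurableSet[G] (A i) := by
      rw [hG]; exact MeasurableSpace.measurableSet_generateFrom ⟨i, rfl⟩
    have h3 : MeasurableSet[MeasurableSpace.comap φ inferInstance] (φ ⁻¹' {x j}) :=
      ⟨{x j}, measurableSet_singleton _, rfl⟩
    exact @MeasurableSet.inter _ (G ⊔ MeasurableSpace.comap φ inferInstance) _ _
      ((le_sup_right : _ ≤ G ⊔ MeasurableSpace.comap φ inferInstance) _ h3)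
      ((le_sup_left : _ ≤ G ⊔ MeasurableSpace.comap φ inferInstance) _ h2)
  refine ⟨φ, hφm, ?_, ?_, ?_⟩
  · refine Measure.ext (fun s hs => ?_)
    rw [Measure.map_apply hφm hs, hlaw s hs]
  · refine IndepSets.indep (p1 := {t | MeasurableSet[MeasurableSpace.comap φ inferInstance] t})
      (p2 := Set.range A) hφm.comap_le hGle
      (@MeasurableSpace.isPiSystem_measurableSet _ (MeasurableSpace.comap φ inferInstance))
      ?_ (@MeasurableSpace.generateFrom_measurableSet _ (MeasurableSpace.comap φ inferInstance)).symm
      hG ?_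
    · rintro _ ⟨i, rfl⟩ _ ⟨l, rfl⟩ ⟨ω, h1, h2⟩
      rw [hA1 i l ω h1 h2, inter_self]
      exact ⟨l, rfl⟩
    · rw [IndepSets_iff]
      rintro _ _ ⟨s, hs, rfl⟩ ⟨i, rfl⟩
      rw [hkey i s hs, hlaw s hs]
  · refine ⟨⋃ i, ⋃ j, ⋃ (_ : C i j ⊆ F), C i j,
      ⋃ i, ⋃ j, ⋃ (_ : ¬ Disjoint (C i j) F), C i j, ?_, ?_, ?_, ?_, ?_⟩
    · exact MeasurableSet.iUnion fun i => MeasurableSet.iUnion fun j =>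
        MeasurableSet.iUnion fun _ => hCG i j
    · exact MeasurableSet.iUnion fun i => MeasurableSet.iUnion fun j =>
        MeasurableSet.iUnion fun _ => hCG i j
    · exact iUnion_subset fun i => iUnion_subset fun j => iUnion_subset fun h => h
    · intro ω hω
      simp only [mem_iUnion, exists_prop]
      exact ⟨(P ω).1, (P ω).2, fun h => Set.disjoint_left.1 h (hP ω) hω, hP ω⟩
    · set T : Finset (Fin k) :=
        Finset.univ.filter (fun i => ¬ Disjoint (A i) F ∧ ¬ A i ⊆ F) with hT
      have hsub : ((⋃ i, ⋃ j, ⋃ (_ : ¬ Disjoint (C i j) F), C i j) \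
          (⋃ i, ⋃ j, ⋃ (_ : C i j ⊆ F), C i j)) ⊆ ⋃ i ∈ T, C i (j0 i) := by
        rintro ω ⟨h1, h2⟩
        simp only [mem_iUnion, exists_prop, not_exists, not_and] at h1 h2 ⊢
        obtain ⟨i, j, hd, hω⟩ := h1
        have hns : ¬ C i j ⊆ F := fun h => h2 i j h hω
        have hj : j = j0 i := by
          by_contra hne
          rcases hj0 i j hne with h | h
          · exact hns h
          · exact hd h
        refine ⟨i, ?_, hj ▸ hω⟩
        simp only [hT, Finset.mem_filter, Finset.mem_univ, true_and]
        exact ⟨fun h => hd (h.mono_left (hCA i j)), fun h => hns ((hCA i j).trans h)⟩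
      have hbound : ∑ i ∈ T, μ (A i) ≤ sInf {m : ℝ≥0∞ | ∃ G₁ G₂ : Set Ω,
          MeasurableSet[G] G₁ ∧ MeasurableSet[G] G₂ ∧
            G₁ ⊆ F ∧ F ⊆ G₂ ∧ m = μ (G₂ \ G₁)} := by
        refine le_sInf ?_
        rintro _ ⟨G₁, G₂, hG1, hG2, h1, h2, rfl⟩
        rw [hG] at hG1 hG2
        rw [← measure_biUnion_finset (fun a _ b _ hab => hdisj hab) (fun i _ => hAmeas i)]
        refine measure_mono (iUnion₂_subset fun i hi => ?_)
        simp only [hT, Finset.mem_filter, Finset.mem_univ, true_and] at hi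
        obtain ⟨u, hu, huF⟩ := Set.not_disjoint_iff.1 hi.1
        obtain ⟨v, hv, hvF⟩ := Set.not_subset.1 hi.2
        intro ω hω
        exact ⟨generateFrom_partition_atom A hdisj G₂ hG2 i u hu ω hω (h2 huF), fun h =>
          hvF (h1 (generateFrom_partition_atom A hdisj G₁ hG1 i ω hω v hv h))⟩
      calc _ ≤ μ (⋃ i ∈ T, C i (j0 i)) := measure_mono hsub
        _ ≤ ∑ i ∈ T, μ (C i (j0 i)) := measure_biUnion_finset_le _ _
        _ ≤ ∑ i ∈ T, (⨆ j, ENNReal.ofReal (α j)) * μ (A i) := by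
          refine Finset.sum_le_sum fun i _ => ?_
          rw [hCμ]
          gcongr
          exact le_iSup (fun j => ENNReal.ofReal (α j)) (j0 i)
        _ = (⨆ j, ENNReal.ofReal (α j)) * ∑ i ∈ T, μ (A i) := by rw [Finset.mul_sum]
        _ ≤ _ := by gcongr
end
end
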